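/- Let d ≥ 2 be an integer, φ ≥ 2d a real, n_q ≥ 1 an integer, d̂ := ⌈d/2⌉, m_i = (d/(φ+d))·((2φ/(φ−d))^i − 1), and k_i := ⌈m_i⌉. For i = 1,...,n_q, j = 1,...,d, l = 1,...,k_i, let b_{i,j}^{(l)} be an object of weight 2^i/(k_i·d̂) whose profit vector is drawn uniformly from Q_{i,j}/k_i, the set of vectors in ℝ^d whose j-th coordinate lies in (m_i/k_i − 1/φ, m_i/k_i] and whose other coordinates lie in [0, 1/φ]. Let the solution set S force, for each fixed (i,j), all objects b_{i,j}^{(1)},...,b_{i,j}^{(k_i)} to be chosen together or not at all, and require that for each i the chosen pattern over j = 1,...,d lies in Ŝ = { x ∈ {0,1}^d : H(x) ∈ {0, d̂} }. Then the expected number of Pareto optimal solutions of K_S({ b_{i,j}^{(l)} }) is at least (2^d / d)^{n_q}. -/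

import Mathlib

open MeasureTheory Finset

/-- Total weight (or total profit) of a 0-1 solution `s`. -/
def totalVal {ι : Type*} [Fintype ι] (w : ι → ℝ) (s : ι → Bool) : ℝ :=
  ∑ i, if s i then w i else 0

/-- Multi-criteria domination: `s'` is no heavier, has no smaller profit in each of
the `d` profit criteria, and is strictly better in at least one of the `d+1` criteria. -/
def dominatesD {ι : Type*} [Fintype ι] {d : ℕ} (w : ι → ℝ) (P : ι → Fin d → ℝ)
    (s' s : ι → Bool) : Prop :=
  totalVal w s' ≤ totalVal w s ∧
    (∀ j, totalVal (fun i => P i j) s ≤ totalVal (fun i => P i j) s') ∧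
    (totalVal w s' < totalVal w s ∨
      ∃ j, totalVal (fun i => P i j) s < totalVal (fun i => P i j) s')

/-- Pareto set of the `(d+1)`-dimensional knapsack problem with solution set `S`,
weights `w` and profit vectors `P`. -/
def paretoSetD {ι : Type*} [Fintype ι] {d : ℕ} (S : Set (ι → Bool)) (w : ι → ℝ)
    (P : ι → Fin d → ℝ) : Set (ι → Bool) :=
  {s ∈ S | ∀ s' ∈ S, ¬ dominatesD w P s' s}

/-- The uniform probability measure on a set of reals. -/
noncomputable def unifOn (s : Set ℝ) : Measure ℝ :=
  (volume s)⁻¹ • volume.restrict s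

theorem isProbabilityMeasure_unifOn {s : Set ℝ} (h0 : volume s ≠ 0) (ht : volume s ≠ ⊤) :
    IsProbabilityMeasure (unifOn s) := by
  refine ⟨?_⟩
  simp only [unifOn, Measure.smul_apply, Measure.restrict_apply_univ, smul_eq_mul]
  exact ENNReal.inv_mul_cancel h0 ht

theorem ae_mem_unifOn {s : Set ℝ} (hs : MeasurableSet s) : ∀ᵐ x ∂unifOn s, x ∈ s :=
  Measure.ae_smul_measure (ae_restrict_mem hs) _

theorem two_pow_le_mul_choose_middle {d : ℕ} (hd : 2 ≤ d) : 2 ^ d ≤ d * d.choose (d / 2) := by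
  obtain ⟨e, rfl⟩ : ∃ e, d = e + 1 := ⟨d - 1, by omega⟩
  have h2 : 2 ≤ (e + 1).choose ((e + 1) / 2) := by
    have := Nat.choose_le_middle 1 (e + 1)
    rw [Nat.choose_one_right] at this
    omega
  rw [← Nat.sum_range_choose, Finset.sum_range_succ, Finset.sum_range_succ']
  have h3 : ∑ i ∈ Finset.range e, (e + 1).choose (i + 1)
      ≤ e * (e + 1).choose ((e + 1) / 2) := by
    simpa using Finset.sum_le_card_nsmul (Finset.range e) (fun i => (e + 1).choose (i + 1)) _
      (fun i _ => Nat.choose_le_middle (i + 1) (e + 1))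
  rw [Nat.choose_self, Nat.choose_zero_right]
  nlinarith

/-- Two sequences agreeing above index `i` are ordered as soon as the gap at `i` exceeds the total
possible loss below `i`. -/
theorem sum_lt_sum_of_dominant_index {n : ℕ} (i : Fin n) (f g : Fin n → ℝ) (u : ℕ → ℝ)
    (habove : ∀ l, i < l → f l = g l) (hbelow : ∀ l, l < i → f l ≤ g l + u l)
    (hi : f i + ∑ l ∈ Finset.range i, u l < g i) : ∑ l, f l < ∑ l, g l := by
  have hu : ∑ l : Fin n, (if l < i then u l else 0) = ∑ l ∈ Finset.range i, u l := by
    have h := Fin.sum_univ_eq_sum_range (fun l => if l < (i : ℕ) then u l else 0) n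
    simp only [Fin.lt_def]
    rw [h, ← Finset.sum_filter]
    congr 1
    ext l
    have := i.isLt
    simp only [Finset.mem_filter, Finset.mem_range]
    omega
  have hg : ∑ l, (if l = i then g i - f i else 0) = g i - f i := by simp
  have : ∑ l, f l ≤ ∑ l, (g l + (if l < i then u l else 0) - (if l = i then g i - f i else 0)) := by
    refine Finset.sum_le_sum fun l _ => ?_
    rcases lt_trichotomy l i with h | h | h
    · simpa [h, h.ne] using hbelow l h
    · subst h; simp
    · simp [h.ne', not_lt.2 h.le, habove l h]
  rw [Finset.sum_sub_distrib, Finset.sum_add_distrib, hu, hg] at this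
  linarith

theorem exists_max_ne {n : ℕ} {α : Type*} {A B : Fin n → α} (h : A ≠ B) :
    ∃ i, A i ≠ B i ∧ ∀ l, i < l → A l = B l := by
  classical
  have hne : (Finset.univ.filter fun i => A i ≠ B i).Nonempty := by
    obtain ⟨i, hi⟩ := Function.ne_iff.1 h
    exact ⟨i, by simpa using hi⟩
  refine ⟨_, (Finset.mem_filter.1 (Finset.max'_mem _ hne)).2, fun l hl => ?_⟩
  by_contra hc
  exact absurd (Finset.le_max' _ l (by simpa using hc)) (not_le.2 hl)

/-- Binary weights: patterns of size `0` or `c` in which the heaviest differing level is empty on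
the left and nonempty on the right have increasing total weight. -/
theorem binary_weight_lt {n d c : ℕ} (hc : 0 < c) (A B : Fin n → Finset (Fin d))
    (hA : ∀ i, (A i).card = 0 ∨ (A i).card = c) (i : Fin n)
    (habove : ∀ l, i < l → A l = B l) (hAi : (A i).card = 0) (hBi : (B i).card = c) :
    ∑ l, ((A l).card : ℝ) * (2 ^ ((l : ℕ) + 1) / c) <
      ∑ l, ((B l).card : ℝ) * (2 ^ ((l : ℕ) + 1) / c) := by
  have hc' : (0 : ℝ) < c := by exact_mod_cast hc
  refine sum_lt_sum_of_dominant_index i _ _ (fun l => 2 ^ (l + 1))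
    (fun l hl => by rw [habove l hl]) (fun l _ => ?_) ?_
  · have h1 : ((A l).card : ℝ) * (2 ^ ((l : ℕ) + 1) / c) ≤ 2 ^ ((l : ℕ) + 1) := by
      rcases hA l with h | h
      · rw [h]; simp
      · rw [h, mul_div_cancel₀ _ hc'.ne']
    have h2 : 0 ≤ ((B l).card : ℝ) * (2 ^ ((l : ℕ) + 1) / c) := by positivity
    linarith
  · have hs : ∀ t : ℕ, ∑ l ∈ Finset.range t, (2 : ℝ) ^ (l + 1) < 2 ^ (t + 1) := by
      intro t
      induction t with
      | zero => simp
      | succ t ih => rw [Finset.sum_range_succ, pow_succ 2 (t + 1)]; linarith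
    have := hs i
    rw [hAi, hBi, mul_div_cancel₀ _ hc'.ne']
    simpa using this

/-- The profit levels solve the recursion in which each level exactly outweighs all lower ones. -/
theorem sum_profit_levels {d φ : ℝ} (hd : 0 < d) (hφ : 2 * d ≤ φ) (m : ℕ → ℝ)
    (hm : ∀ i, m i = (d / (φ + d)) * ((2 * φ / (φ - d)) ^ i - 1)) (t : ℕ) :
    ∑ l ∈ Finset.range t, (m (l + 1) + d * (m (l + 1) + 1) / φ) =
      m (t + 1) - d * (m (t + 1) + 1) / φ := by
  have h1 : φ - d ≠ 0 := by linarith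
  have h2 : φ + d ≠ 0 := by linarith
  have h3 : φ ≠ 0 := by linarith
  have hrec : ∀ i, m (i + 1) = (2 * φ * m i + 2 * φ * d / (φ + d)) / (φ - d) - d / (φ + d) := by
    intro i
    rw [hm, hm, pow_succ]
    field_simp
    ring
  induction t with
  | zero =>
    simp only [Finset.range_zero, Finset.sum_empty, zero_add, hm, pow_one]
    field_simp
    ring
  | succ t ih =>
    rw [Finset.sum_range_succ, ih, hrec (t + 1)]
    field_simp
    ring

/-- Distinct patterns with the lighter one on the left: some profit criterion strictly favours the
heavier one. -/
theorem exists_profit_lt {n d c : ℕ} (hc : 0 < c) (hcd : c + 1 ≤ d) {φ : ℝ}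
    (hφ : 2 * (d : ℝ) ≤ φ) (m : ℕ → ℝ) (κ : Fin n → ℝ)
    (hm : ∀ i, m i = ((d : ℝ) / (φ + d)) * ((2 * φ / (φ - d)) ^ i - 1))
    (hκ0 : ∀ i, 0 ≤ κ i) (hκ : ∀ i, κ i ≤ m ((i : ℕ) + 1) + 1)
    (q : Fin n → Fin d → Fin d → ℝ)
    (hdiag : ∀ (i : Fin n) j, m ((i : ℕ) + 1) - κ i / φ < q i j j ∧ q i j j ≤ m ((i : ℕ) + 1))
    (hoff : ∀ i j j', j ≠ j' → 0 ≤ q i j j' ∧ q i j j' ≤ κ i / φ)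
    (A B : Fin n → Finset (Fin d))
    (hA : ∀ i, (A i).card = 0 ∨ (A i).card = c) (hB : ∀ i, (B i).card = 0 ∨ (B i).card = c)
    (hAB : A ≠ B)
    (hw : ∑ l, ((B l).card : ℝ) * (2 ^ ((l : ℕ) + 1) / c) ≤
      ∑ l, ((A l).card : ℝ) * (2 ^ ((l : ℕ) + 1) / c)) :
    ∃ j, ∑ i, ∑ j' ∈ B i, q i j' j < ∑ i, ∑ j' ∈ A i, q i j' j := by
  obtain ⟨i, hne, habove⟩ := exists_max_ne hAB
  have hd0 : (0 : ℝ) < d := by exact_mod_cast (by omega : 0 < d)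
  have hφ0 : 0 < φ := by linarith
  have hcdR : (c : ℝ) + 1 ≤ d := by exact_mod_cast hcd
  have hsum := sum_profit_levels hd0 hφ m hm
  have hm0 : ∀ t, 0 ≤ m (t + 1) := by
    intro t
    rw [hm]
    have : (1 : ℝ) ≤ (2 * φ / (φ - d)) ^ (t + 1) := by
      refine one_le_pow₀ ?_
      rw [le_div_iff₀ (by linarith)]
      linarith
    have : (0 : ℝ) ≤ d / (φ + d) := by positivity
    exact mul_nonneg this (by linarith)
  have hκm : ∀ l : Fin n, κ l / φ ≤ m ((l : ℕ) + 1) := by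
    intro l
    have h0 : 0 ≤ m ((l : ℕ) + 1) - d * (m ((l : ℕ) + 1) + 1) / φ := by
      rw [← hsum]
      exact Finset.sum_nonneg fun t _ => by have := hm0 t; positivity
    have h1 : κ l / φ ≤ d * (m ((l : ℕ) + 1) + 1) / φ := by
      gcongr
      have := hκ l
      have := hm0 l
      have : (1 : ℝ) ≤ d := by linarith [(Nat.cast_nonneg c : (0 : ℝ) ≤ c)]
      nlinarith
    linarith
  have hq0 : ∀ l j' j, 0 ≤ q l j' j := by
    intro l j' j
    by_cases h : j' = j
    · subst h; linarith [(hdiag l j').1, hκm l]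
    · exact (hoff l j' j h).1
  have hAi : (A i).card = c := by
    refine (hA i).resolve_left fun h0 => ?_
    refine absurd hw (not_le.2 (binary_weight_lt hc A B hA i habove h0 ?_))
    refine (hB i).resolve_left fun h0' => hne ?_
    rw [Finset.card_eq_zero.1 h0, Finset.card_eq_zero.1 h0']
  obtain ⟨j, hjA, hjB⟩ : ∃ j ∈ A i, j ∉ B i := by
    by_contra! hsub
    refine hne (Finset.eq_of_subset_of_card_le hsub ?_)
    rcases hB i with h | h <;> omega
  refine ⟨j, sum_lt_sum_of_dominant_index i _ _
    (fun l => m (l + 1) + d * (m (l + 1) + 1) / φ) (fun l hl => by rw [habove l hl])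
    (fun l _ => ?_) ?_⟩
  · have hA0 : 0 ≤ ∑ j' ∈ A l, q l j' j := Finset.sum_nonneg fun j' _ => hq0 l j' j
    have hκφ : 0 ≤ κ l / φ := div_nonneg (hκ0 l) hφ0.le
    have hBu : ∑ j' ∈ B l, q l j' j ≤
        ∑ j' ∈ B l, (κ l / φ + if j' = j then m ((l : ℕ) + 1) else 0) := by
      refine Finset.sum_le_sum fun j' _ => ?_
      by_cases h : j' = j
      · subst h; simpa using (hdiag l j').2.trans (le_add_of_nonneg_left hκφ)
      · simpa [h] using (hoff l j' j h).2
    have hite : ∑ j' ∈ B l, (if j' = j then m ((l : ℕ) + 1) else 0) ≤ m ((l : ℕ) + 1) := by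
      rw [Finset.sum_ite_eq']
      split_ifs
      · exact le_rfl
      · exact hm0 l
    rw [Finset.sum_add_distrib, Finset.sum_const, nsmul_eq_mul] at hBu
    have h3 : ((B l).card : ℝ) * (κ l / φ) ≤ d * (m ((l : ℕ) + 1) + 1) / φ := by
      rw [mul_div_assoc]
      have := hκ l
      have : (B l).card ≤ d := (Finset.card_le_univ _).trans_eq (Fintype.card_fin d)
      have := hm0 l
      gcongr
    linarith
  · rw [hsum]
    have h1 : ∑ j' ∈ B i, q i j' j ≤ (B i).card * (κ i / φ) := by
      rw [← nsmul_eq_mul]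
      exact Finset.sum_le_card_nsmul _ _ _ fun j' hj' =>
        (hoff i j' j (fun h => hjB (h ▸ hj'))).2
    have h2 : q i j j ≤ ∑ j' ∈ A i, q i j' j :=
      Finset.single_le_sum (f := fun j' => q i j' j) (fun j' _ => hq0 i j' j) hjA
    have h3 : (((B i).card : ℝ) + 1) * (κ i / φ) ≤ d * (m ((i : ℕ) + 1) + 1) / φ := by
      rw [mul_div_assoc]
      have := hκ i
      have : ((B i).card : ℝ) ≤ c := by rcases hB i with h | h <;> simp [h]
      have := hm0 i
      have := hκ0 i
      gcongr
      linarith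
    linarith [(hdiag i j).1]

/-- The set of groups picked at level `i`. -/
def levelPattern {n d : ℕ} {k : Fin n → ℕ} (s : ((i : Fin n) × (Fin d × Fin (k i))) → Bool)
    (i : Fin n) : Finset (Fin d) :=
  Finset.univ.filter fun j : Fin d => ∃ l : Fin (k i), s ⟨i, (j, l)⟩

/-- The value of a grouped solution is the sum of the values of the groups it picks. -/
theorem totalVal_eq_sum_levelPattern {n d : ℕ} {k : Fin n → ℕ}
    (s : ((i : Fin n) × (Fin d × Fin (k i))) → Bool)
    (hs : ∀ (i : Fin n) (j : Fin d) (l l' : Fin (k i)), s ⟨i, (j, l)⟩ = s ⟨i, (j, l')⟩)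
    (v : ((i : Fin n) × (Fin d × Fin (k i))) → ℝ) :
    totalVal v s = ∑ i, ∑ j ∈ levelPattern s i, ∑ l, v ⟨i, (j, l)⟩ := by
  rw [totalVal, Fintype.sum_sigma]
  refine Finset.sum_congr rfl fun i _ => ?_
  rw [Fintype.sum_prod_type, levelPattern, Finset.sum_filter]
  refine Finset.sum_congr rfl fun j _ => ?_
  split_ifs with h
  · obtain ⟨l, hl⟩ := h
    exact Finset.sum_congr rfl fun l' _ => by rw [if_pos ((hs i j l' l).trans hl)]
  · push Not at h
    exact Finset.sum_eq_zero fun l' _ => if_neg (h l')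

theorem levelPattern_injective {n d : ℕ} {k : Fin n → ℕ}
    {s s' : ((i : Fin n) × (Fin d × Fin (k i))) → Bool}
    (hs : ∀ (i : Fin n) (j : Fin d) (l l' : Fin (k i)), s ⟨i, (j, l)⟩ = s ⟨i, (j, l')⟩)
    (hs' : ∀ (i : Fin n) (j : Fin d) (l l' : Fin (k i)), s' ⟨i, (j, l)⟩ = s' ⟨i, (j, l')⟩)
    (h : levelPattern s = levelPattern s') : s = s' := by
  have key : ∀ {t : ((i : Fin n) × (Fin d × Fin (k i))) → Bool},
      (∀ (i : Fin n) (j : Fin d) (l l' : Fin (k i)), t ⟨i, (j, l)⟩ = t ⟨i, (j, l')⟩) →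
      ∀ i j l, t ⟨i, (j, l)⟩ = true ↔ j ∈ levelPattern t i := by
    intro t ht i j l
    simp only [levelPattern, Finset.mem_filter, Finset.mem_univ, true_and]
    exact ⟨fun h => ⟨l, h⟩, fun ⟨l', hl'⟩ => (ht i j l l').trans hl'⟩
  funext ⟨i, j, l⟩
  rw [Bool.eq_iff_iff, key hs, key hs', h]

theorem choose_pow_le_ncard {n d c : ℕ} {k : Fin n → ℕ} (hk : ∀ i, 0 < k i) :
    d.choose c ^ n ≤ {s : ((i : Fin n) × (Fin d × Fin (k i))) → Bool |
      (∀ (i : Fin n) (j : Fin d) (l l' : Fin (k i)), s ⟨i, (j, l)⟩ = s ⟨i, (j, l')⟩) ∧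
      ∀ i, (levelPattern s i).card = 0 ∨ (levelPattern s i).card = c}.ncard := by
  classical
  let T := Finset.powersetCard c (Finset.univ : Finset (Fin d))
  let F : (Fin n → T) → ((i : Fin n) × (Fin d × Fin (k i))) → Bool :=
    fun x y => decide (y.2.1 ∈ (x y.1 : Finset (Fin d)))
  have hF : ∀ x i, levelPattern (F x) i = x i := by
    intro x i
    ext j
    have : Nonempty (Fin (k i)) := ⟨⟨0, hk i⟩⟩
    simp [levelPattern, F]
  have hinj : Function.Injective F := by
    intro x y hxy
    funext i
    exact Subtype.ext (by rw [← hF x i, ← hF y i, hxy])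
  have hcard : d.choose c ^ n = (Set.range F).ncard := by
    rw [← Set.image_univ, Set.ncard_image_of_injective _ hinj, Set.ncard_univ,
      Nat.card_eq_fintype_card]
    simp [T]
  rw [hcard]
  refine Set.ncard_le_ncard ?_ (Set.toFinite _)
  rintro _ ⟨x, rfl⟩
  exact ⟨fun _ _ _ _ => rfl, fun i => Or.inr (by
    rw [hF]; exact (Finset.mem_powersetCard.1 (x i).2).2)⟩

/-- Splitting each object `b_{i,j}` into `k_i = ⌈m_i⌉` grouped
objects `b_{i,j}^(l)` of weight `2^i/(k_i·d̂)` with profit vectors drawn uniformly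
from `Q_{i,j}/k_i` (the `j`-th coordinate uniform in `(m_i/k_i - 1/φ, m_i/k_i]`,
all other coordinates uniform in `[0, 1/φ]`), with a solution set forcing each
group to be taken completely or not at all and each per-level pattern to lie in
`Ŝ = {x : H(x) ∈ {0, d̂}}`, the expected number of Pareto optimal solutions is at
least `(2^d/d)^{n_q}`. -/
theorem expected_pareto_lower_bound_multi (d : ℕ) (hd : 2 ≤ d) (φ : ℝ)
    (hφ : 2 * d ≤ φ) (nq : ℕ) (hnq : 1 ≤ nq)
    (dHat : ℕ) (hdHat : (dHat : ℤ) = ⌈(d : ℚ) / 2⌉)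
    (m : ℕ → ℝ)
    (hm : ∀ i, m i = ((d : ℝ) / (φ + d)) * ((2 * φ / (φ - d)) ^ i - 1))
    (k : Fin nq → ℕ) (hk : ∀ i : Fin nq, (k i : ℤ) = ⌈m ((i : ℕ) + 1)⌉)
    (S : Set (((i : Fin nq) × (Fin d × Fin (k i))) → Bool))
    (hS : S = {s | (∀ (i : Fin nq) (j : Fin d) (l l' : Fin (k i)),
        s ⟨i, (j, l)⟩ = s ⟨i, (j, l')⟩) ∧
      ∀ i : Fin nq,
        (Finset.univ.filter fun j : Fin d => ∃ l : Fin (k i), s ⟨i, (j, l)⟩).card = 0 ∨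
        (Finset.univ.filter fun j : Fin d => ∃ l : Fin (k i), s ⟨i, (j, l)⟩).card = dHat}) :
    ENNReal.ofReal (((2 : ℝ) ^ d / d) ^ nq) ≤
      ∫⁻ P : ((i : Fin nq) × (Fin d × Fin (k i))) → Fin d → ℝ,
        ((paretoSetD S
            (fun x : (i : Fin nq) × (Fin d × Fin (k i)) =>
              (2 : ℝ) ^ ((x.1 : ℕ) + 1) / ((k x.1 : ℝ) * dHat))
            P).ncard : ENNReal)
        ∂(Measure.pi fun x : (i : Fin nq) × (Fin d × Fin (k i)) =>
            Measure.pi fun j' : Fin d =>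
              if j' = x.2.1 then
                unifOn (Set.Ioc (m ((x.1 : ℕ) + 1) / (k x.1 : ℝ) - 1 / φ)
                  (m ((x.1 : ℕ) + 1) / (k x.1 : ℝ)))
              else unifOn (Set.Icc 0 (1 / φ))) := by
  have hd2 : (2 : ℝ) ≤ d := by exact_mod_cast hd
  have hφ0 : 0 < φ := by linarith
  have hc : dHat = d - d / 2 := by
    rw [eq_comm, Int.ceil_eq_iff] at hdHat
    obtain ⟨h1, h2⟩ := hdHat
    push_cast at h1 h2
    have h1' : (2 * dHat : ℚ) < d + 2 := by linarith
    have h2' : (d : ℚ) ≤ 2 * dHat := by linarith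
    have h1'' : 2 * dHat < d + 2 := by exact_mod_cast h1'
    have h2'' : d ≤ 2 * dHat := by exact_mod_cast h2'
    omega
  have hm0 : ∀ t, 0 < m (t + 1) := by
    intro t
    rw [hm]
    have h1 : (1 : ℝ) < (2 * φ / (φ - d)) ^ (t + 1) := by
      refine one_lt_pow₀ ?_ (Nat.succ_ne_zero t)
      rw [lt_div_iff₀ (by linarith)]
      linarith
    exact mul_pos (by positivity) (by linarith)
  have hk0 : ∀ i, 0 < k i := by
    intro i
    have : (0 : ℤ) < k i := by rw [hk]; exact Int.ceil_pos.2 (hm0 i)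
    exact_mod_cast this
  have hk1 : ∀ i, (k i : ℝ) ≤ m ((i : ℕ) + 1) + 1 := by
    intro i
    have h := (Int.ceil_lt_add_one (m ((i : ℕ) + 1))).le
    rw [← hk] at h
    exact_mod_cast h
  have hkR : ∀ i, (0 : ℝ) < k i := fun i => by exact_mod_cast hk0 i
  have hprob : ∀ (x : (i : Fin nq) × (Fin d × Fin (k i))) (j' : Fin d), IsProbabilityMeasure
      (if j' = x.2.1 then
        unifOn (Set.Ioc (m ((x.1 : ℕ) + 1) / (k x.1 : ℝ) - 1 / φ)
          (m ((x.1 : ℕ) + 1) / (k x.1 : ℝ)))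
      else unifOn (Set.Icc 0 (1 / φ))) := by
    intro x j'
    split_ifs <;> refine isProbabilityMeasure_unifOn ?_ ?_ <;> simp [hφ0]
  have hae : ∀ᵐ P ∂(Measure.pi fun x : (i : Fin nq) × (Fin d × Fin (k i)) =>
      Measure.pi fun j' : Fin d =>
        if j' = x.2.1 then
          unifOn (Set.Ioc (m ((x.1 : ℕ) + 1) / (k x.1 : ℝ) - 1 / φ)
            (m ((x.1 : ℕ) + 1) / (k x.1 : ℝ)))
        else unifOn (Set.Icc 0 (1 / φ))),
      ∀ x j', P x j' ∈ (if j' = x.2.1 then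
        Set.Ioc (m ((x.1 : ℕ) + 1) / (k x.1 : ℝ) - 1 / φ) (m ((x.1 : ℕ) + 1) / (k x.1 : ℝ))
        else Set.Icc 0 (1 / φ)) := by
    rw [ae_all_iff]
    intro x
    refine (Measure.quasiMeasurePreserving_eval (fun x : (i : Fin nq) × (Fin d × Fin (k i)) =>
      Measure.pi fun j' : Fin d =>
        if j' = x.2.1 then
          unifOn (Set.Ioc (m ((x.1 : ℕ) + 1) / (k x.1 : ℝ) - 1 / φ)
            (m ((x.1 : ℕ) + 1) / (k x.1 : ℝ)))
        else unifOn (Set.Icc 0 (1 / φ))) x).ae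
      (p := fun y : Fin d → ℝ => ∀ j', y j' ∈ (if j' = x.2.1 then
        Set.Ioc (m ((x.1 : ℕ) + 1) / (k x.1 : ℝ) - 1 / φ) (m ((x.1 : ℕ) + 1) / (k x.1 : ℝ))
        else Set.Icc 0 (1 / φ))) ?_
    rw [ae_all_iff]
    intro j'
    refine (Measure.quasiMeasurePreserving_eval (fun j' : Fin d =>
        if j' = x.2.1 then
          unifOn (Set.Ioc (m ((x.1 : ℕ) + 1) / (k x.1 : ℝ) - 1 / φ)
            (m ((x.1 : ℕ) + 1) / (k x.1 : ℝ)))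
        else unifOn (Set.Icc 0 (1 / φ))) j').ae
      (p := fun y : ℝ => y ∈ (if j' = x.2.1 then
        Set.Ioc (m ((x.1 : ℕ) + 1) / (k x.1 : ℝ) - 1 / φ) (m ((x.1 : ℕ) + 1) / (k x.1 : ℝ))
        else Set.Icc 0 (1 / φ))) ?_
    split_ifs
    · exact ae_mem_unifOn measurableSet_Ioc
    · exact ae_mem_unifOn measurableSet_Icc
  have hS' : S = {s | (∀ (i : Fin nq) (j : Fin d) (l l' : Fin (k i)),
      s ⟨i, (j, l)⟩ = s ⟨i, (j, l')⟩) ∧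
      ∀ i, (levelPattern s i).card = 0 ∨ (levelPattern s i).card = dHat} := hS
  have hcount : ((2 : ℝ) ^ d / d) ^ nq ≤ S.ncard := by
    have h1 : (2 : ℝ) ^ d / d ≤ d.choose dHat := by
      rw [div_le_iff₀ (by linarith), mul_comm, hc, Nat.choose_symm (Nat.div_le_self d 2)]
      exact_mod_cast two_pow_le_mul_choose_middle hd
    calc ((2 : ℝ) ^ d / d) ^ nq ≤ (d.choose dHat : ℝ) ^ nq := by gcongr
      _ ≤ S.ncard := by rw [hS']; exact_mod_cast choose_pow_le_ncard hk0
  calc ENNReal.ofReal (((2 : ℝ) ^ d / d) ^ nq) ≤ (S.ncard : ENNReal) := by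
        rw [← ENNReal.ofReal_natCast]; exact ENNReal.ofReal_le_ofReal hcount
    _ = ∫⁻ _ : ((i : Fin nq) × (Fin d × Fin (k i))) → Fin d → ℝ, (S.ncard : ENNReal)
        ∂(Measure.pi fun x : (i : Fin nq) × (Fin d × Fin (k i)) =>
            Measure.pi fun j' : Fin d =>
              if j' = x.2.1 then
                unifOn (Set.Ioc (m ((x.1 : ℕ) + 1) / (k x.1 : ℝ) - 1 / φ)
                  (m ((x.1 : ℕ) + 1) / (k x.1 : ℝ)))
              else unifOn (Set.Icc 0 (1 / φ))) := by
        rw [lintegral_const, measure_univ, mul_one]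
    _ ≤ _ := lintegral_mono_ae ?_
  filter_upwards [hae] with P hP
  refine Nat.cast_le.2 (Set.ncard_le_ncard (fun s hs => ⟨hs, fun s' hs' hdom => ?_⟩) (Set.toFinite _))
  obtain ⟨hw, hp, hstrict⟩ := hdom
  rw [hS'] at hs hs'
  by_cases hss : levelPattern s = levelPattern s'
  · obtain rfl := levelPattern_injective hs.1 hs'.1 hss
    simp at hstrict
  have hweight : ∀ t : ((i : Fin nq) × (Fin d × Fin (k i))) → Bool,
      (∀ (i : Fin nq) (j : Fin d) (l l' : Fin (k i)), t ⟨i, (j, l)⟩ = t ⟨i, (j, l')⟩) →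
      totalVal (fun x : (i : Fin nq) × (Fin d × Fin (k i)) =>
        (2 : ℝ) ^ ((x.1 : ℕ) + 1) / ((k x.1 : ℝ) * dHat)) t =
      ∑ i, ((levelPattern t i).card : ℝ) * (2 ^ ((i : ℕ) + 1) / dHat) := by
    intro t ht
    rw [totalVal_eq_sum_levelPattern t ht]
    refine Finset.sum_congr rfl fun i _ => ?_
    have := (hkR i).ne'
    simp only [Finset.sum_const, Finset.card_univ, Fintype.card_fin, nsmul_eq_mul]
    field_simp
  rw [hweight s hs.1, hweight s' hs'.1] at hw
  have hdiag : ∀ (i : Fin nq) (j : Fin d),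
      m ((i : ℕ) + 1) - k i / φ < ∑ l, P ⟨i, (j, l)⟩ j ∧
        ∑ l, P ⟨i, (j, l)⟩ j ≤ m ((i : ℕ) + 1) := by
    intro i j
    have hPj : ∀ l, P ⟨i, (j, l)⟩ j ∈ Set.Ioc (m ((i : ℕ) + 1) / (k i : ℝ) - 1 / φ)
        (m ((i : ℕ) + 1) / (k i : ℝ)) := fun l => by simpa using hP ⟨i, (j, l)⟩ j
    have : Nonempty (Fin (k i)) := ⟨⟨0, hk0 i⟩⟩
    have hki := (hkR i).ne'
    constructor
    · calc m ((i : ℕ) + 1) - k i / φ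
          = ∑ _l : Fin (k i), (m ((i : ℕ) + 1) / (k i : ℝ) - 1 / φ) := by
            simp only [Finset.sum_const, Finset.card_univ, Fintype.card_fin, nsmul_eq_mul]
            field_simp
        _ < _ := Finset.sum_lt_sum_of_nonempty Finset.univ_nonempty fun l _ => (hPj l).1
    · calc ∑ l, P ⟨i, (j, l)⟩ j ≤ ∑ _l : Fin (k i), m ((i : ℕ) + 1) / (k i : ℝ) :=
            Finset.sum_le_sum fun l _ => (hPj l).2
        _ = m ((i : ℕ) + 1) := by
            simp only [Finset.sum_const, Finset.card_univ, Fintype.card_fin, nsmul_eq_mul]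
            field_simp
  have hoff : ∀ (i : Fin nq) (j j' : Fin d), j ≠ j' →
      0 ≤ ∑ l, P ⟨i, (j, l)⟩ j' ∧ ∑ l, P ⟨i, (j, l)⟩ j' ≤ k i / φ := by
    intro i j j' hjj
    have hPj : ∀ l, P ⟨i, (j, l)⟩ j' ∈ Set.Icc 0 (1 / φ) := fun l => by
      simpa [hjj.symm] using hP ⟨i, (j, l)⟩ j'
    refine ⟨Finset.sum_nonneg fun l _ => (hPj l).1, ?_⟩
    calc ∑ l, P ⟨i, (j, l)⟩ j' ≤ ∑ _l : Fin (k i), 1 / φ :=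
          Finset.sum_le_sum fun l _ => (hPj l).2
      _ = k i / φ := by
          simp only [Finset.sum_const, Finset.card_univ, Fintype.card_fin, nsmul_eq_mul]
          ring
  obtain ⟨j, hj⟩ := exists_profit_lt (n := nq) (c := dHat) (by omega) (by omega) hφ m
    (fun i => (k i : ℝ)) hm (fun i => (hkR i).le) hk1
    (fun i j' j => ∑ l, P ⟨i, (j', l)⟩ j) hdiag hoff
    (levelPattern s) (levelPattern s') hs.2 hs'.2 hss hw
  refine absurd (hp j) (not_le.2 ?_)
  rw [totalVal_eq_sum_levelPattern s hs.1, totalVal_eq_sum_levelPattern s' hs'.1]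
  exact hj
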